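/- (Bourgain) Let X be a separable Banach space such that for every countable compact metric space K the Banach space C(K) of continuous real-valued functions on K with the supremum norm embeds isomorphically into X. Then C([0,1]) embeds isomorphically into X. -/

import Mathlib

/-- An isomorphic embedding of Banach spaces: a bounded linear map which is
bounded below (hence an isomorphism onto its range). -/
def IsIsomorphicEmbedding {Y X : Type*} [NormedAddCommGroup Y] [NormedSpace ℝ Y]
    [NormedAddCommGroup X] [NormedSpace ℝ X] (T : Y →L[ℝ] X) : Prop :=
  ∃ c : ℝ, 0 < c ∧ ∀ y : Y, c * ‖y‖ ≤ ‖T y‖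

/-- `Y` embeds isomorphically into `X`. -/
def EmbedsInto (Y X : Type*) [NormedAddCommGroup Y] [NormedSpace ℝ Y]
    [NormedAddCommGroup X] [NormedSpace ℝ X] : Prop :=
  ∃ T : Y →L[ℝ] X, IsIsomorphicEmbedding T

/-- `X` is `K`-elastic: whenever a Banach space `Y` embeds isomorphically into `X`,
there is an embedding `T : Y → X` with `‖y‖ ≤ ‖T y‖ ≤ K * ‖y‖` for all `y`. -/
def IsKElastic (X : Type*) [NormedAddCommGroup X] [NormedSpace ℝ X] (K : ℝ) : Prop :=
  ∀ (Y : Type) [NormedAddCommGroup Y] [NormedSpace ℝ Y] [CompleteSpace Y],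
    EmbedsInto Y X → ∃ T : Y →L[ℝ] X, ∀ y : Y, ‖y‖ ≤ ‖T y‖ ∧ ‖T y‖ ≤ K * ‖y‖


namespace BourgainAux

open Filter Topology

abbrev Z := ℕ → Bool

/-- `Big α A`: the set `A` can be split `α` times by clopen sets. -/
inductive Big : Ordinal.{0} → Set Z → Prop
  | mk {α : Ordinal.{0}} {A : Set Z} (hne : A.Nonempty) (U : Ordinal.{0} → Set Z)
      (hU : ∀ β, IsClopen (U β)) (h1 : ∀ β, β < α → Big β (A ∩ U β))
      (h2 : ∀ β, β < α → Big β (A \ U β)) : Big α A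

lemma Big.nonempty {α : Ordinal.{0}} {A : Set Z} (h : Big α A) : A.Nonempty := by
  cases h with
  | mk hne => exact hne

lemma Big.split {α β : Ordinal.{0}} {A : Set Z} (h : Big α A) (hb : β < α) :
    ∃ U, IsClopen U ∧ Big β (A ∩ U) ∧ Big β (A \ U) := by
  cases h with
  | mk hne U hU h1 h2 => exact ⟨U β, hU β, h1 β hb, h2 β hb⟩

lemma Big.mono {α : Ordinal.{0}} {A : Set Z} (h : Big α A) :
    ∀ {B : Set Z}, A ⊆ B → Big α B := by
  induction h with
  | mk hne U hU h1 h2 ih1 ih2 =>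
    intro B hB
    exact Big.mk (hne.mono hB) U hU
      (fun β hb => ih1 β hb (Set.inter_subset_inter_left _ hB))
      (fun β hb => ih2 β hb (Set.sdiff_subset_sdiff_left hB))

lemma Big.image {α : Ordinal.{0}} {A : Set Z} (h : Big α A) (σ g : Z → Z)
    (hg : Continuous g) (hgs : ∀ x, g (σ x) = x) : Big α (σ '' A) := by
  induction h with
  | mk hne U hU h1 h2 ih1 ih2 =>
    refine Big.mk (hne.image σ) (fun β => g ⁻¹' U β) (fun β => (hU β).preimage hg) ?_ ?_
    · intro β hb
      refine (ih1 β hb).mono ?_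
      rintro _ ⟨x, hx, rfl⟩
      exact ⟨⟨x, hx.1, rfl⟩, by simpa [hgs] using hx.2⟩
    · intro β hb
      refine (ih2 β hb).mono ?_
      rintro _ ⟨x, hx, rfl⟩
      exact ⟨⟨x, hx.1, rfl⟩, by simpa [hgs] using hx.2⟩

def sh (n : ℕ) (x : Z) : Z := fun k => x (k + (n + 1))

def ins (n : ℕ) (x : Z) : Z := fun k => if k < n then false else if k = n then true else x (k - (n + 1))

lemma sh_ins (n : ℕ) (x : Z) : sh n (ins n x) = x := by
  funext k
  have h1 : ¬ (k + (n + 1) < n) := by omega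
  have h2 : ¬ (k + (n + 1) = n) := by omega
  simp only [sh, ins, h1, h2, if_false, Nat.add_sub_cancel]

lemma sh_cont (n : ℕ) : Continuous (sh n) := by
  unfold sh
  fun_prop

def P (n : ℕ) (x : Z) : Prop := (∀ k < n, x k = false) ∧ x n = true

lemma P_ins (n : ℕ) (x : Z) : P n (ins n x) := by
  constructor
  · intro k hk
    simp [ins, hk]
  · simp [ins]

lemma P_unique {n m : ℕ} {x : Z} (hn : P n x) (hm : P m x) : n = m := by
  rcases lt_trichotomy n m with h | h | h
  · have := hm.1 n h
    rw [hn.2] at this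
    cases this
  · exact h
  · have := hn.1 m h
    rw [hm.2] at this
    cases this

lemma ins_sh {n : ℕ} {x : Z} (h : P n x) : ins n (sh n x) = x := by
  funext k
  unfold ins sh
  split_ifs with h1 h2
  · exact (h.1 k h1).symm
  · rw [h2]; exact h.2.symm
  · congr 1; omega

lemma P_clopen (n : ℕ) : IsClopen {x : Z | P n x} := by
  have e : {x : Z | P n x} = (⋂ k ∈ Set.Iio n, {x : Z | x k = false}) ∩ {x : Z | x n = true} := by
    ext x
    simp [P]
  rw [e]
  have key : ∀ (k : ℕ) (b : Bool), IsClopen {x : Z | x k = b} := fun k b =>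
    (isClopen_discrete ({b} : Set Bool)).preimage (continuous_apply k)
  exact ((Set.finite_Iio n).isClopen_biInter (fun k _ => key k false)).inter (key n true)

theorem exists_big (α : Ordinal.{0}) (hα : (Set.Iio α).Countable) :
    ∃ K : Set Z, IsClosed K ∧ K.Countable ∧ Big α K := by
  induction α using WellFoundedLT.induction with
  | ind α ih =>
  have ih' : ∀ β : Set.Iio α, ∃ K : Set Z, IsClosed K ∧ K.Countable ∧ Big β K := fun β =>
    ih β.1 β.2 (hα.mono (Set.Iio_subset_Iio (le_of_lt β.2)))
  choose K hcl hct hbig using ih'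
  by_cases hne : Nonempty (Set.Iio α)
  · haveI : Countable (Set.Iio α) := hα.to_subtype
    obtain ⟨e, he⟩ := exists_surjective_nat (Set.Iio α)
    let L : Set Z := {x | ∀ n, P n x → sh n x ∈ K (e (n / 2))}
    have hsub : ∀ n, ins n '' K (e (n / 2)) ⊆ L := by
      rintro n _ ⟨x, hx, rfl⟩ m hm
      have := P_unique hm (P_ins n x)
      subst this
      rwa [sh_ins]
    refine ⟨L, ?_, ?_, ?_⟩
    · have : L = ⋂ n, ({x : Z | P n x}ᶜ ∪ sh n ⁻¹' K (e (n / 2))) := by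
        ext x
        simp only [L, Set.mem_ofPred_eq, Set.mem_iInter, Set.mem_union, Set.mem_compl_iff,
          Set.mem_preimage]
        exact forall_congr' fun n => imp_iff_not_or
      rw [this]
      exact isClosed_iInter fun n => (P_clopen n).compl.isClosed.union
        ((hcl _).preimage (sh_cont n))
    · have : L ⊆ {fun _ => false} ∪ ⋃ n, ins n '' K (e (n / 2)) := by
        intro x hx
        by_cases h0 : ∃ n, x n = true
        · right
          have hP : P (Nat.find h0) x := by
            refine ⟨fun k hk => ?_, Nat.find_spec h0⟩
            have := Nat.find_min h0 hk
            simpa using this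
          exact Set.mem_iUnion.2 ⟨Nat.find h0, _, hx _ hP, ins_sh hP⟩
        · left
          push Not at h0
          funext k
          simpa using h0 k
      exact ((Set.countable_singleton _).union
        (Set.countable_iUnion fun n => (hct _).image _)).mono this
    · have hb : ∀ n, Big (e (n / 2)) (ins n '' K (e (n / 2))) := fun n =>
        (hbig _).image (ins n) (sh n) (sh_cont n) (sh_ins n)
      have hs : ∀ β : Ordinal.{0}, ∃ U, IsClopen U ∧ (β < α → Big β (L ∩ U) ∧ Big β (L \ U)) := by
        intro β
        by_cases hβ : β < α
        · obtain ⟨j, hj⟩ := he ⟨β, hβ⟩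
          refine ⟨{x | P (2 * j) x}, P_clopen _, fun _ => ⟨?_, ?_⟩⟩
          · have h1 := hb (2 * j)
            have e1 : 2 * j / 2 = j := by omega
            have h1s := hsub (2 * j)
            rw [e1] at h1 h1s
            have h2 : Big β (ins (2 * j) '' K (e j)) := by rw [hj] at h1 ⊢; exact h1
            refine h2.mono (Set.subset_inter h1s ?_)
            rintro _ ⟨x, _, rfl⟩
            exact P_ins _ _
          · have h1 := hb (2 * j + 1)
            have e1 : (2 * j + 1) / 2 = j := by omega
            have h1s := hsub (2 * j + 1)
            rw [e1] at h1 h1s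
            have h2 : Big β (ins (2 * j + 1) '' K (e j)) := by rw [hj] at h1 ⊢; exact h1
            refine h2.mono ?_
            intro y hy
            refine ⟨h1s hy, ?_⟩
            obtain ⟨x, _, rfl⟩ := hy
            intro hP
            have := P_unique hP (P_ins (2 * j + 1) x)
            omega
        · exact ⟨∅, isClopen_empty, fun h => absurd h hβ⟩
      choose U hU hUs using hs
      exact Big.mk (((hb 0).nonempty).mono (hsub 0)) U hU (fun β h => (hUs β h).1)
        (fun β h => (hUs β h).2)
  · refine ⟨{fun _ => false}, isClosed_singleton, Set.countable_singleton _,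
      Big.mk (Set.singleton_nonempty _) (fun _ => ∅) (fun _ => isClopen_empty) ?_ ?_⟩
    · intro β hb
      exact absurd ⟨⟨β, hb⟩⟩ hne
    · intro β hb
      exact absurd ⟨⟨β, hb⟩⟩ hne

section Analysis

variable {X : Type} [NormedAddCommGroup X] [NormedSpace ℝ X]

/-- `y 0, …, y (2^n-1)` is equivalent to the sup-norm basis. -/
def Good (M n : ℕ) (y : ℕ → X) : Prop :=
  ∀ a : ℕ → ℝ, (∀ j < 2 ^ n, |a j| ≤ ‖∑ i ∈ Finset.range (2 ^ n), a i • y i‖) ∧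
    ∀ C : ℝ, (∀ i < 2 ^ n, |a i| ≤ C) → ‖∑ i ∈ Finset.range (2 ^ n), a i • y i‖ ≤ M * C

def Near (n : ℕ) (y y' : ℕ → X) : Prop :=
  ∀ j < 2 ^ n, ‖y' (2 * j) + y' (2 * j + 1) - y j‖ ≤ (1 / 4) ^ n

lemma sum_double {G : Type} [AddCommMonoid G] (g : ℕ → G) (n : ℕ) :
    ∑ j ∈ Finset.range (2 * n), g j = ∑ j ∈ Finset.range n, (g (2 * j) + g (2 * j + 1)) := by
  induction n with
  | zero => simp
  | succ n ih =>
    rw [Finset.sum_range_succ _ n, ← ih, show 2 * (n + 1) = 2 * n + 1 + 1 by ring,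
      Finset.sum_range_succ, Finset.sum_range_succ, add_assoc]

lemma step_bound (y : ℕ → ℕ → X) (N : ℕ) (hN : ∀ n ≥ N, Near n (y n) (y (n + 1)))
    (n : ℕ) (hn : N ≤ n) (b : ℕ → ℝ) (B : ℝ) (hb : ∀ j, |b j| ≤ B) (k : ℕ) :
    ‖∑ j ∈ Finset.range (2 ^ (n + k)), b (j / 2 ^ k) • y (n + k) j -
      ∑ j ∈ Finset.range (2 ^ n), b j • y n j‖ ≤ B * (2 * (1 / 2) ^ n - 2 * (1 / 2) ^ (n + k)) := by
  have hB : 0 ≤ B := (abs_nonneg _).trans (hb 0)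
  induction k with
  | zero => simp
  | succ k ih =>
    have e : ∑ j ∈ Finset.range (2 ^ (n + (k + 1))), b (j / 2 ^ (k + 1)) • y (n + (k + 1)) j -
        ∑ j ∈ Finset.range (2 ^ (n + k)), b (j / 2 ^ k) • y (n + k) j =
        ∑ j ∈ Finset.range (2 ^ (n + k)), b (j / 2 ^ k) •
          (y (n + k + 1) (2 * j) + y (n + k + 1) (2 * j + 1) - y (n + k) j) := by
      rw [show 2 ^ (n + (k + 1)) = 2 * 2 ^ (n + k) by ring, sum_double, ← Finset.sum_sub_distrib]
      refine Finset.sum_congr rfl fun j _ => ?_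
      have e1 : 2 * j / 2 ^ (k + 1) = j / 2 ^ k := by
        rw [pow_succ', ← Nat.div_div_eq_div_mul]
        congr 1; omega
      have e2 : (2 * j + 1) / 2 ^ (k + 1) = j / 2 ^ k := by
        rw [pow_succ', ← Nat.div_div_eq_div_mul]
        congr 1; omega
      rw [e1, e2, ← smul_add, ← smul_sub, add_assoc n k 1]
    have h1 : ‖∑ j ∈ Finset.range (2 ^ (n + k)), b (j / 2 ^ k) •
          (y (n + k + 1) (2 * j) + y (n + k + 1) (2 * j + 1) - y (n + k) j)‖ ≤
          B * (1 / 2) ^ (n + k) := by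
      calc _ ≤ ∑ j ∈ Finset.range (2 ^ (n + k)), B * (1 / 4 : ℝ) ^ (n + k) := by
            refine norm_sum_le_of_le _ fun j hj => ?_
            rw [norm_smul]
            exact mul_le_mul (hb _) (hN (n + k) (by omega) j (Finset.mem_range.1 hj))
              (norm_nonneg _) hB
        _ = B * (1 / 2) ^ (n + k) := by
            rw [Finset.sum_const, Finset.card_range, nsmul_eq_mul]
            push_cast
            rw [show (1 / 4 : ℝ) = 1 / 2 * (1 / 2) by norm_num, mul_pow]
            have : (2 : ℝ) ^ (n + k) * (1 / 2) ^ (n + k) = 1 := by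
              rw [← mul_pow]; norm_num
            linear_combination B * (1 / 2) ^ (n + k) * this
    rw [← e] at h1
    calc _ ≤ _ := norm_sub_le_norm_sub_add_norm_sub _
            (∑ j ∈ Finset.range (2 ^ (n + k)), b (j / 2 ^ k) • y (n + k) j) _
      _ ≤ _ := add_le_add h1 ih
      _ = _ := by ring

/-- dyadic points, clamped to `[0,1]` -/
noncomputable def pt (n j : ℕ) : Set.Icc (0:ℝ) 1 :=
  Set.projIcc 0 1 zero_le_one ((j : ℝ) / 2 ^ n)

lemma pt_dist (s t n j : ℕ) (x : Set.Icc (0:ℝ) 1)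
    (h : |(j : ℝ) / 2 ^ n - x| ≤ (1 / 2) ^ s) (_ : t = t) : dist (pt n j) x ≤ (1 / 2) ^ s := by
  have : x = Set.projIcc 0 1 zero_le_one (x : ℝ) := (Set.projIcc_val _ x).symm
  rw [this, pt, Subtype.dist_eq, Real.dist_eq]
  exact (Set.abs_projIcc_sub_projIcc zero_le_one).trans h

lemma pt_near (n k j : ℕ) : dist (pt (n + k) j) (pt n (j / 2 ^ k)) ≤ (1 / 2) ^ n := by
  rw [pt, pt, Subtype.dist_eq, Real.dist_eq]
  refine (Set.abs_projIcc_sub_projIcc zero_le_one).trans ?_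
  have h1 : (j : ℝ) = 2 ^ k * ((j / 2 ^ k : ℕ) : ℝ) + ((j % 2 ^ k : ℕ) : ℝ) := by
    exact_mod_cast (Nat.div_add_mod j (2 ^ k)).symm
  have h2 : ((j % 2 ^ k : ℕ) : ℝ) ≤ 2 ^ k := by
    exact_mod_cast (Nat.mod_lt j (by positivity)).le
  have h3 : (j : ℝ) / 2 ^ (n + k) - ((j / 2 ^ k : ℕ) : ℝ) / 2 ^ n =
      ((j % 2 ^ k : ℕ) : ℝ) / 2 ^ (n + k) := by
    rw [pow_add]
    field_simp
    linarith
  rw [h3, abs_of_nonneg (by positivity), pow_add, one_div, inv_pow, div_le_iff₀ (by positivity)]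
  have : ((2 : ℝ) ^ n)⁻¹ * (2 ^ n * 2 ^ k) = 2 ^ k := by field_simp
  rw [this]
  exact h2

lemma exists_pt_near (n : ℕ) (x : Set.Icc (0:ℝ) 1) :
    ∃ j < 2 ^ n, dist (pt n j) x ≤ (1 / 2) ^ n := by
  have hx0 := x.2.1
  have hx1 := x.2.2
  have hp : (0 : ℝ) < 2 ^ n := by positivity
  by_cases h : (x : ℝ) < 1
  · refine ⟨⌊(x : ℝ) * 2 ^ n⌋₊, ?_, pt_dist n 0 n _ x ?_ rfl⟩
    · rw [Nat.floor_lt (by positivity)]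
      push_cast
      nlinarith
    · have h1 := Nat.floor_le (show 0 ≤ (x : ℝ) * 2 ^ n by positivity)
      have h2 := Nat.lt_floor_add_one ((x : ℝ) * 2 ^ n)
      have e : ((⌊(x : ℝ) * 2 ^ n⌋₊ : ℝ)) / 2 ^ n - x =
        ((⌊(x : ℝ) * 2 ^ n⌋₊ : ℝ) - x * 2 ^ n) / 2 ^ n := by field_simp
      rw [e, abs_div, abs_of_pos hp, div_le_iff₀ hp, ← mul_pow]
      norm_num
      rw [abs_le]
      constructor <;> linarith
  · have hx : (x : ℝ) = 1 := le_antisymm hx1 (not_lt.1 h)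
    refine ⟨2 ^ n - 1, Nat.sub_lt (by positivity) one_pos, pt_dist n 0 n _ x ?_ rfl⟩
    rw [hx, Nat.cast_sub Nat.one_le_two_pow]
    push_cast
    have e : ((2 : ℝ) ^ n - 1) / 2 ^ n - 1 = - (1 / 2) ^ n := by
      rw [one_div, inv_pow]
      field_simp
      ring
    rw [e, abs_neg, abs_of_pos (by positivity)]

theorem embed_of_branch [CompleteSpace X] (M N : ℕ) (y : ℕ → ℕ → X)
    (hG : ∀ n ≥ N, Good M n (y n)) (hN : ∀ n ≥ N, Near n (y n) (y (n + 1))) :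
    EmbedsInto C(Set.Icc (0:ℝ) 1, ℝ) X := by
  let T : ℕ → C(Set.Icc (0:ℝ) 1, ℝ) →L[ℝ] X := fun n =>
    ∑ j ∈ Finset.range (2 ^ n), (ContinuousMap.evalCLM ℝ (pt n j)).smulRight (y n j)
  have hT : ∀ n f, T n f = ∑ j ∈ Finset.range (2 ^ n), f (pt n j) • y n j := by
    intro n f
    simp [T]
  have hpow : Tendsto (fun n : ℕ => (1 / 2 : ℝ) ^ n) atTop (𝓝 0) :=
    tendsto_pow_atTop_nhds_zero_of_lt_one (by norm_num) (by norm_num)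
  have hcau : ∀ f, CauchySeq fun n => T n f := by
    intro f
    rw [Metric.cauchySeq_iff']
    intro ε hε
    have huc : UniformContinuous f := CompactSpace.uniformContinuous_of_continuous f.continuous
    rw [Metric.uniformContinuous_iff] at huc
    obtain ⟨δ, hδ, hf⟩ := huc (ε / (2 * (M + 1))) (by positivity)
    have ev1 : ∀ᶠ n : ℕ in atTop, (1 / 2 : ℝ) ^ n < δ := hpow.eventually_lt_const hδ
    have ev2 : ∀ᶠ n : ℕ in atTop, (1 / 2 : ℝ) ^ n < ε / (4 * (‖f‖ + 1)) :=
      hpow.eventually_lt_const (by positivity)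
    obtain ⟨n, ⟨h1, h2⟩, hn⟩ := ((ev1.and ev2).and (eventually_ge_atTop N)).exists
    refine ⟨n, fun m hm => ?_⟩
    obtain ⟨k, rfl⟩ := Nat.exists_eq_add_of_le hm
    rw [dist_eq_norm]
    have hA := step_bound y N hN n hn (fun j => f (pt n j)) ‖f‖
      (fun j => f.norm_coe_le_norm (pt n j)) k
    have hB : ‖∑ j ∈ Finset.range (2 ^ (n + k)),
        (f (pt (n + k) j) - f (pt n (j / 2 ^ k))) • y (n + k) j‖ ≤ M * (ε / (2 * (M + 1))) := by
      refine (hG (n + k) (by omega) _).2 _ fun i _ => ?_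
      have := hf (lt_of_le_of_lt (pt_near n k i) h1)
      rw [Real.dist_eq] at this
      exact this.le
    have hC : M * (ε / (2 * (M + 1))) < ε / 2 := by
      rw [← mul_div_assoc, div_lt_div_iff₀ (by positivity) (by norm_num)]
      nlinarith
    have hD : ‖f‖ * (2 * (1 / 2) ^ n - 2 * (1 / 2) ^ (n + k)) ≤ ε / 2 := by
      have h0 : (0:ℝ) < (1 / 2) ^ (n + k) := by positivity
      have hf0 := norm_nonneg f
      rw [lt_div_iff₀ (by positivity)] at h2
      have h00 : (0:ℝ) < (1 / 2) ^ n := by positivity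
      nlinarith [mul_nonneg hf0 h0.le]
    have e : T (n + k) f - T n f = ∑ j ∈ Finset.range (2 ^ (n + k)),
        (f (pt (n + k) j) - f (pt n (j / 2 ^ k))) • y (n + k) j +
        (∑ j ∈ Finset.range (2 ^ (n + k)), f (pt n (j / 2 ^ k)) • y (n + k) j -
      ∑ j ∈ Finset.range (2 ^ n), f (pt n j) • y n j) := by
      rw [hT, hT]
      simp only [sub_smul, Finset.sum_sub_distrib]
      abel
    rw [e]
    refine lt_of_le_of_lt (norm_add_le _ _) ?_
    have := add_le_add hB (hA.trans hD)
    linarith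
  choose g hg using fun f => cauchySeq_tendsto_of_complete (hcau f)
  refine ⟨continuousLinearMapOfTendsto T (tendsto_pi_nhds.2 hg), 1, one_pos, fun f => ?_⟩
  change 1 * ‖f‖ ≤ ‖g f‖
  rw [one_mul, ContinuousMap.norm_le _ (norm_nonneg _)]
  intro x
  choose j hj hjx using fun n => exists_pt_near n x
  have hlim : Tendsto (fun n => pt n (j n)) atTop (𝓝 x) := by
    rw [tendsto_iff_dist_tendsto_zero]
    exact squeeze_zero (fun _ => dist_nonneg) hjx hpow
  have hlim2 : Tendsto (fun n => ‖f (pt n (j n))‖) atTop (𝓝 ‖f x‖) :=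
    ((f.continuous.tendsto x).comp hlim).norm
  refine le_of_tendsto_of_tendsto hlim2 (hg f).norm ?_
  filter_upwards [eventually_ge_atTop N] with n hn
  rw [hT]
  exact (hG n hn (fun i => f (pt n i))).1 (j n) (hj n)

lemma good_of_approx (n : ℕ) (x y : ℕ → X) (M : ℕ) (D : ℝ) (hM : D + 1 ≤ M)
    (hx : ∀ a : ℕ → ℝ, (∀ j < 2 ^ n, 2 * |a j| ≤ ‖∑ i ∈ Finset.range (2 ^ n), a i • x i‖) ∧
    ∀ C : ℝ, (∀ i < 2 ^ n, |a i| ≤ C) → ‖∑ i ∈ Finset.range (2 ^ n), a i • x i‖ ≤ D * C)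
    (hxy : ∀ j < 2 ^ n, ‖y j - x j‖ ≤ (1 / 4) ^ n / 4) : Good M n y := by
  intro a
  have key : ∀ C : ℝ, (∀ i < 2 ^ n, |a i| ≤ C) →
      ‖∑ i ∈ Finset.range (2 ^ n), a i • y i - ∑ i ∈ Finset.range (2 ^ n), a i • x i‖ ≤ C := by
    intro C hC
    have hC0 : 0 ≤ C := (abs_nonneg _).trans (hC 0 (by positivity))
    rw [← Finset.sum_sub_distrib]
    calc _ ≤ ∑ j ∈ Finset.range (2 ^ n), C * ((1 / 4 : ℝ) ^ n) := by
            refine norm_sum_le_of_le _ fun j hj => ?_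
            have hj := Finset.mem_range.1 hj
            rw [← smul_sub, norm_smul]
            refine mul_le_mul (hC j hj) ((hxy j hj).trans ?_) (norm_nonneg _) hC0
            have : (0:ℝ) < (1 / 4) ^ n := by positivity
            linarith
      _ = C * (1 / 2) ^ n := by
            rw [Finset.sum_const, Finset.card_range, nsmul_eq_mul]
            push_cast
            rw [show (1 / 4 : ℝ) = 1 / 2 * (1 / 2) by norm_num, mul_pow]
            have : (2 : ℝ) ^ n * (1 / 2) ^ n = 1 := by
              rw [← mul_pow]; norm_num
            linear_combination C * (1 / 2) ^ n * this
      _ ≤ C := mul_le_of_le_one_right hC0 (pow_le_one₀ (by norm_num) (by norm_num))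
  constructor
  · intro j hj
    obtain ⟨m, hm, hmax⟩ := Finset.exists_max_image (Finset.range (2 ^ n)) (fun i => |a i|)
      ⟨j, Finset.mem_range.2 hj⟩
    have h1 := key |a m| fun i hi => hmax i (Finset.mem_range.2 hi)
    have h2 := (hx a).1 m (Finset.mem_range.1 hm)
    have h3 := hmax j (Finset.mem_range.2 hj)
    have h4 := norm_sub_norm_le (∑ i ∈ Finset.range (2 ^ n), a i • x i)
      (∑ i ∈ Finset.range (2 ^ n), a i • y i)
    rw [norm_sub_rev] at h4
    linarith
  · intro C hC
    have hC0 : 0 ≤ C := (abs_nonneg _).trans (hC 0 (by positivity))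
    have h1 := key C hC
    have h2 := (hx a).2 C hC
    have h4 := norm_sub_norm_le (∑ i ∈ Finset.range (2 ^ n), a i • y i)
      (∑ i ∈ Finset.range (2 ^ n), a i • x i)
    have := mul_le_mul_of_nonneg_right hM hC0
    linarith


open Classical in
/-- indicator of a clopen set, restricted to `K` -/
noncomputable def chi (K : Set Z) (U : Set Z) : C(K, ℝ) :=
  if hU : IsClopen U then
    (LocallyConstant.charFn ℝ (hU.preimage (continuous_subtype_val (p := (· ∈ K)))) :
      LocallyConstant K ℝ).toContinuousMap
  else 0

open Classical in
lemma chi_apply (K U : Set Z) (hU : IsClopen U) (x : K) :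
    chi K U x = if (x : Z) ∈ U then 1 else 0 := by
  rw [chi, dif_pos hU]
  change (LocallyConstant.charFn ℝ (hU.preimage (continuous_subtype_val (p := (· ∈ K)))) :
    LocallyConstant K ℝ) x = _
  rw [LocallyConstant.coe_charFn, Set.indicator_apply]
  rfl

lemma chi_split (K U W : Set Z) (hU : IsClopen U) (hW : IsClopen W) :
    chi K (U ∩ W) + chi K (U \ W) = chi K U := by
  ext x
  rw [ContinuousMap.add_apply, chi_apply _ _ (hU.inter hW), chi_apply _ _ (hU.diff hW),
    chi_apply _ _ hU]
  by_cases h1 : (x : Z) ∈ U <;> by_cases h2 : (x : Z) ∈ W <;> simp [h1, h2]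

lemma chi_sum (K : Set Z) [CompactSpace K] (m : ℕ) (U : ℕ → Set Z)
    (hU : ∀ j < m, IsClopen (U j)) (hd : ∀ i < m, ∀ j < m, i ≠ j → Disjoint (U i) (U j))
    (hne : ∀ j < m, (K ∩ U j).Nonempty) (a : ℕ → ℝ) :
    (∀ j < m, |a j| ≤ ‖∑ i ∈ Finset.range m, a i • chi K (U i)‖) ∧
    ∀ C : ℝ, 0 ≤ C → (∀ i < m, |a i| ≤ C) → ‖∑ i ∈ Finset.range m, a i • chi K (U i)‖ ≤ C := by
  have ev : ∀ x : K, ∀ j < m, (x : Z) ∈ U j →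
      (∑ i ∈ Finset.range m, a i • chi K (U i)) x = a j := by
    intro x j hj hx
    rw [ContinuousMap.sum_apply, Finset.sum_eq_single j]
    · simp [chi_apply _ _ (hU j hj), hx]
    · intro i hi hij
      have hi := Finset.mem_range.1 hi
      have : (x : Z) ∉ U i := fun h => Set.disjoint_left.1 (hd i hi j hj hij) h hx
      simp [chi_apply _ _ (hU i hi), this]
    · intro h
      exact absurd (Finset.mem_range.2 hj) h
  constructor
  · intro j hj
    obtain ⟨x, hxK, hxU⟩ := hne j hj
    rw [← ev ⟨x, hxK⟩ j hj hxU]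
    exact ContinuousMap.norm_coe_le_norm (∑ i ∈ Finset.range m, a i • chi K (U i)) ⟨x, hxK⟩
  · intro C hC0 hC
    rw [ContinuousMap.norm_le _ hC0]
    intro x
    by_cases hx : ∃ j < m, (x : Z) ∈ U j
    · obtain ⟨j, hj, hxj⟩ := hx
      rw [ev x j hj hxj]
      exact hC j hj
    · push Not at hx
      rw [ContinuousMap.sum_apply, Finset.sum_eq_zero, norm_zero]
      · exact hC0
      · intro i hi
        have hi := Finset.mem_range.1 hi
        simp [chi_apply _ _ (hU i hi), hx i hi]

/-- Node: constant, level, list of indices into a dense sequence. -/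
abbrev Node := ℕ × ℕ × List ℕ

def vec (d : ℕ → X) (l : List ℕ) : ℕ → X := fun j => d (l.getD j 0)

/-- `Rel d v u`: the node `v` is a child of the node `u`. -/
def Rel (d : ℕ → X) (v u : Node) : Prop :=
  v.1 = u.1 ∧ v.2.1 = u.2.1 + 1 ∧ Good u.1 u.2.1 (vec d u.2.2) ∧
    Near u.2.1 (vec d u.2.2) (vec d v.2.2)

lemma exists_list (d : ℕ → X) (hd : DenseRange d) (m : ℕ) (x : ℕ → X) (ε : ℝ) (hε : 0 < ε) :
    ∃ l : List ℕ, ∀ j < m, ‖vec d l j - x j‖ ≤ ε := by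
  choose g hg using fun j => hd.exists_dist_lt (x j) hε
  refine ⟨(List.range m).map g, fun j hj => ?_⟩
  have : vec d ((List.range m).map g) j = d (g j) := by
    simp [vec, List.getD, hj]
  rw [this, ← dist_eq_norm, dist_comm]
  exact (hg j).le

lemma rank_ge (d : ℕ → X) (hd : DenseRange d) [hwf : IsWellFounded Node (Rel d)]
    (K : Set Z) [CompactSpace K] (L : C(K, ℝ) →L[ℝ] X) (c : ℝ) (hc : 0 < c)
    (hL : ∀ f, c * ‖f‖ ≤ ‖L f‖) (M : ℕ) (hM : 2 / c * ‖L‖ + 1 ≤ M) (β : Ordinal.{0}) :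
    ∀ (n : ℕ) (l : List ℕ) (U : ℕ → Set Z), (∀ j < 2 ^ n, IsClopen (U j)) →
      (∀ i < 2 ^ n, ∀ j < 2 ^ n, i ≠ j → Disjoint (U i) (U j)) →
      (∀ j < 2 ^ n, Big β (K ∩ U j)) →
      (∀ j < 2 ^ n, ‖vec d l j - (2 / c) • L (chi K (U j))‖ ≤ (1 / 4) ^ n / 4) →
      β ≤ IsWellFounded.rank (Rel d) (M, n, l) := by
  induction β using WellFoundedLT.induction with
  | ind β ih =>
  intro n l U hU hdis hbig hl
  by_contra! hlt
  have hs : ∀ j, ∃ W, j < 2 ^ n → IsClopen W ∧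
      Big (IsWellFounded.rank (Rel d) (M, n, l)) (K ∩ U j ∩ W) ∧
      Big (IsWellFounded.rank (Rel d) (M, n, l)) ((K ∩ U j) \ W) := by
    intro j
    by_cases hj : j < 2 ^ n
    · obtain ⟨W, hW⟩ := (hbig j hj).split hlt
      exact ⟨W, fun _ => hW⟩
    · exact ⟨∅, fun h => absurd h hj⟩
  choose W hW using hs
  let V : ℕ → Set Z := fun k => if k % 2 = 0 then U (k / 2) ∩ W (k / 2) else U (k / 2) \ W (k / 2)
  have hV0 : ∀ j, V (2 * j) = U j ∩ W j := by
    intro j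
    have e1 : 2 * j / 2 = j := by omega
    have e2 : 2 * j % 2 = 0 := by omega
    simp only [V, e1, e2, if_true]
  have hV1 : ∀ j, V (2 * j + 1) = U j \ W j := by
    intro j
    have e1 : (2 * j + 1) / 2 = j := by omega
    have e2 : ¬ ((2 * j + 1) % 2 = 0) := by omega
    simp only [V, e1, e2, if_false]
  have hVU : ∀ k, V k ⊆ U (k / 2) := by
    intro k
    simp only [V]
    split_ifs
    · exact Set.inter_subset_left
    · exact Set.sdiff_subset
  have hpow : 2 ^ (n + 1) = 2 * 2 ^ n := by ring
  have hhalf : ∀ k < 2 ^ (n + 1), k / 2 < 2 ^ n := fun k hk => by omega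
  have hVc : ∀ k < 2 ^ (n + 1), IsClopen (V k) := by
    intro k hk
    have h1 := hU _ (hhalf k hk)
    have h2 := (hW _ (hhalf k hk)).1
    simp only [V]
    split_ifs
    · exact h1.inter h2
    · exact h1.diff h2
  have hVd : ∀ i < 2 ^ (n + 1), ∀ j < 2 ^ (n + 1), i ≠ j → Disjoint (V i) (V j) := by
    intro i hi j hj hij
    by_cases h : i / 2 = j / 2
    · simp only [V, h]
      split_ifs with h1 h2 h2
      · omega
      · exact Set.disjoint_left.2 fun x hx hx' => hx'.2 hx.2
      · exact Set.disjoint_left.2 fun x hx hx' => hx.2 hx'.2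
      · omega
    · exact (hdis _ (hhalf i hi) _ (hhalf j hj) h).mono (hVU i) (hVU j)
  have hVb : ∀ k < 2 ^ (n + 1), Big (IsWellFounded.rank (Rel d) (M, n, l)) (K ∩ V k) := by
    intro k hk
    have h2 := (hW _ (hhalf k hk)).2
    simp only [V]
    split_ifs
    · rw [← Set.inter_assoc]; exact h2.1
    · exact h2.2.mono fun x hx => ⟨hx.1.1, hx.1.2, hx.2⟩
  obtain ⟨l', hl'⟩ := exists_list d hd (2 ^ (n + 1)) (fun j => (2 / c) • L (chi K (V j)))
    ((1 / 4) ^ (n + 1) / 4) (by positivity)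
  have hle := ih _ hlt (n + 1) l' V hVc hVd hVb hl'
  have hrel : Rel d (M, n + 1, l') (M, n, l) := by
    refine ⟨rfl, rfl, ?_, ?_⟩
    · refine good_of_approx n (fun j => (2 / c) • L (chi K (U j))) _ M (2 / c * ‖L‖) hM ?_ hl
      intro a
      have hch := chi_sum K (2 ^ n) U hU hdis (fun j hj => (hbig j hj).nonempty) a
      have e : ∑ i ∈ Finset.range (2 ^ n), a i • (2 / c) • L (chi K (U i)) =
          (2 / c) • L (∑ i ∈ Finset.range (2 ^ n), a i • chi K (U i)) := by
        rw [map_sum, Finset.smul_sum]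
        refine Finset.sum_congr rfl fun i _ => ?_
        rw [map_smul, smul_comm]
      rw [e, norm_smul, Real.norm_of_nonneg (by positivity)]
      constructor
      · intro j hj
        have h1 := hch.1 j hj
        have h2 := hL (∑ i ∈ Finset.range (2 ^ n), a i • chi K (U i))
        have h3 : 2 / c * (c * |a j|) ≤ 2 / c * ‖L (∑ i ∈ Finset.range (2 ^ n), a i • chi K (U i))‖ :=
          mul_le_mul_of_nonneg_left ((mul_le_mul_of_nonneg_left h1 hc.le).trans h2) (by positivity)
        have h4 : 2 / c * (c * |a j|) = 2 * |a j| := by field_simp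
        rwa [h4] at h3
      · intro C hC
        have hC0 : 0 ≤ C := (abs_nonneg _).trans (hC 0 (by positivity))
        rw [mul_assoc]
        refine mul_le_mul_of_nonneg_left ?_ (by positivity)
        exact (L.le_opNorm _).trans
          (mul_le_mul_of_nonneg_left (hch.2 C hC0 hC) (norm_nonneg _))
    · intro j hj
      change j < 2 ^ n at hj
      have h0 := hl j hj
      have h1 := hl' (2 * j) (by omega)
      have h2 := hl' (2 * j + 1) (by omega)
      simp only [hV0, hV1] at h1 h2
      have hsp := chi_split K (U j) (W j) (hU j hj) (hW j hj).1
      have e : vec d l' (2 * j) + vec d l' (2 * j + 1) - vec d l j =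
          (vec d l' (2 * j) - (2 / c) • L (chi K (U j ∩ W j))) +
          (vec d l' (2 * j + 1) - (2 / c) • L (chi K (U j \ W j))) -
          (vec d l j - (2 / c) • L (chi K (U j))) := by
        rw [← hsp, map_add, smul_add]
        abel
      change ‖vec d l' (2 * j) + vec d l' (2 * j + 1) - vec d l j‖ ≤ (1 / 4) ^ n
      rw [e]
      refine (norm_sub_le _ _).trans ((add_le_add (norm_add_le _ _) le_rfl).trans ?_)
      have hp : (0:ℝ) < (1 / 4) ^ n := by positivity
      rw [pow_succ] at h1 h2
      linarith
  exact absurd (IsWellFounded.rank_lt_of_rel hrel) (not_lt.2 hle)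

lemma embeds_of_not_wf [CompleteSpace X] (d : ℕ → X) (h : ¬ WellFounded (Rel d)) :
    EmbedsInto C(Set.Icc (0:ℝ) 1, ℝ) X := by
  rw [wellFounded_iff_isEmpty_descending_chain, not_isEmpty_iff] at h
  obtain ⟨f, hf⟩ := h
  have h1 : ∀ k, (f k).1 = (f 0).1 := by
    intro k
    induction k with
    | zero => rfl
    | succ k ih => rw [(hf k).1, ih]
  have h2 : ∀ k, (f k).2.1 = (f 0).2.1 + k := by
    intro k
    induction k with
    | zero => rfl
    | succ k ih => rw [(hf k).2.1, ih]; ring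
  refine embed_of_branch (f 0).1 (f 0).2.1 (fun n => vec d (f (n - (f 0).2.1)).2.2) ?_ ?_
  · intro n hn
    have := (hf (n - (f 0).2.1)).2.2.1
    rw [h1, h2, Nat.add_sub_of_le hn] at this
    exact this
  · intro n hn
    have := (hf (n - (f 0).2.1)).2.2.2
    rw [h2, Nat.add_sub_of_le hn, show n - (f 0).2.1 + 1 = n + 1 - (f 0).2.1 by omega] at this
    exact this

theorem main [CompleteSpace X] [TopologicalSpace.SeparableSpace X]
    (h : ∀ (K : Type) [TopologicalSpace K] [TopologicalSpace.MetrizableSpace K]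
      [CompactSpace K] [Countable K], EmbedsInto C(K, ℝ) X) :
    EmbedsInto C(Set.Icc (0:ℝ) 1, ℝ) X := by
  let d : ℕ → X := TopologicalSpace.denseSeq X
  have hd : DenseRange d := TopologicalSpace.denseRange_denseSeq X
  by_cases hwf : WellFounded (Rel d)
  swap
  · exact embeds_of_not_wf d hwf
  exfalso
  have : IsWellFounded Node (Rel d) := ⟨hwf⟩
  let α : Ordinal.{0} := ⨆ u : Node, Order.succ (IsWellFounded.rank (Rel d) u)
  have hα : (Set.Iio α).Countable := by
    refine (Set.countable_range (IsWellFounded.rank (Rel d))).mono fun β hβ => ?_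
    obtain ⟨u, hu⟩ := (Ordinal.lt_iSup_iff).1 (show β < α from hβ)
    exact IsWellFounded.mem_range_rank_of_le (Order.lt_succ_iff.1 hu)
  obtain ⟨K, hK, hKc, hKb⟩ := exists_big α hα
  have : CompactSpace K := isCompact_iff_compactSpace.1 hK.isCompact
  have : Countable K := hKc.to_subtype
  obtain ⟨L, c, hc, hL⟩ := h K
  obtain ⟨M, hM⟩ := exists_nat_ge (2 / c * ‖L‖ + 1)
  obtain ⟨l, hl⟩ := exists_list d hd (2 ^ 0) (fun _ => (2 / c) • L (chi K Set.univ))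
    ((1 / 4) ^ 0 / 4) (by positivity)
  have hr := rank_ge d hd K L c hc hL M hM α 0 l (fun _ => Set.univ) (fun _ _ => isClopen_univ)
    (fun i hi j hj hij => by simp at hi hj; omega) (fun _ _ => by simpa using hKb) hl
  have hs : Order.succ (IsWellFounded.rank (Rel d) (M, 0, l)) ≤ α :=
    Ordinal.le_iSup (fun u : Node => Order.succ (IsWellFounded.rank (Rel d) u)) (M, 0, l)
  exact absurd (Order.succ_le_iff.1 hs) (not_lt.2 hr)

end Analysis

end BourgainAux

/-- **Bourgain.** If a separable Banach space `X` is universal for the spaces `C(K)`,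
`K` countable compact metric, then `X` contains an isomorphic copy of `C([0,1])`. -/
theorem bourgain_universal_for_countable_CK
    (X : Type) [NormedAddCommGroup X] [NormedSpace ℝ X] [CompleteSpace X]
    [TopologicalSpace.SeparableSpace X]
    (h : ∀ (K : Type) [MetricSpace K] [CompactSpace K] [Countable K],
      EmbedsInto C(K, ℝ) X) :
    EmbedsInto C(Set.Icc (0:ℝ) 1, ℝ) X := by
  refine BourgainAux.main ?_
  intro K _ _ _ _
  letI := TopologicalSpace.metrizableSpaceMetric K
  exact h K
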